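/- Vectorized broadcast communicability formula: let A^[1],…,A^[M] be real n×n matrices, a > 0 with a·ρ(A^[s]) < 1 for all s, b > 0 and Δt_2,…,Δt_M > 0; set β_1 = 0, β_ℓ = e^{-bΔt_ℓ} for ℓ ≥ 2. Let B be the Mn×Mn block matrix with (k,k) block aA^[k], (k,k+1) block β_{k+1} I_n, zero elsewhere, and let S^[j] be defined by S^[0] = 0, S^[j] = (I + β_j S^[j-1])(I − aA^[j])^{-1} − I. Let d ∈ ℝ^M be the vector with entries d_1 = 1 and d_i = 1 − β_i for i ≥ 2, let e_j ∈ ℝ^M be the j-th standard basis vector, and 1_n ∈ ℝ^n the all-ones vector. Then for each j = 1,…,M, the broadcast vector satisfies S^[j]·1_n = (d ⊗ I_n)^T (I_{Mn} − B)^{-1} (e_j ⊗ 1_n) − 1_n, where ⊗ denotes the Kronecker product. -/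

import Mathlib

open Matrix BigOperators Finset

/-- Spectral radius of a real square matrix: the `ℝ≥0∞`-valued spectral radius of its
complexification, i.e. the maximum modulus of its complex eigenvalues. -/
noncomputable def specRad {ι : Type*} [Fintype ι] [DecidableEq ι]
    (A : Matrix ι ι ℝ) : ENNReal :=
  spectralRadius ℂ (A.map (algebraMap ℝ ℂ))

/-- The ordered product `∏_{s=i}^{j} (I - a A^[s])⁻¹`, factors in increasing order of `s`
(the dynamic communicability matrix `Q^{[i,j]}`). -/
noncomputable def resProd {n : ℕ} (a : ℝ) (A : ℕ → Matrix (Fin n) (Fin n) ℝ) (i j : ℕ) :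
    Matrix (Fin n) (Fin n) ℝ :=
  ((List.range (j + 1 - i)).map (fun t => (1 - a • A (i + t))⁻¹)).prod

/-- The `Mn × Mn` block bidiagonal matrix with diagonal blocks `α A^[k]` (`k = 1,…,M`,
block `k` of `Fin M` corresponding to time index `k+1`), superdiagonal blocks
`β_{k+1} I_n`, and zero blocks elsewhere. -/
noncomputable def blockB {n : ℕ} (M : ℕ) (α : ℝ) (β : ℕ → ℝ)
    (A : ℕ → Matrix (Fin n) (Fin n) ℝ) :
    Matrix (Fin M × Fin n) (Fin M × Fin n) ℝ :=
  fun p q =>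
    if p.1 = q.1 then α * A (p.1.1 + 1) p.2 q.2
    else if p.1.1 + 1 = q.1.1 then (if p.2 = q.2 then β (q.1.1 + 1) else 0)
    else 0

/-- The `(i,j)` block (1-based block indices `1 ≤ i, j ≤ M`) of an `Mn × Mn` matrix. -/
noncomputable def blockOf {n M : ℕ} (C : Matrix (Fin M × Fin n) (Fin M × Fin n) ℝ)
    (i j : ℕ) : Matrix (Fin n) (Fin n) ℝ :=
  fun x y => if h : i - 1 < M ∧ j - 1 < M then C (⟨i - 1, h.1⟩, x) (⟨j - 1, h.2⟩, y) else 0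

/-- If `a ρ(A) < 1` with `a > 0`, then `I - a A` is invertible. -/
theorem isUnit_one_sub_smul_of_specRad_lt {ι : Type*} [Fintype ι] [DecidableEq ι]
    {a : ℝ} (ha : 0 < a) {A : Matrix ι ι ℝ} (h : ENNReal.ofReal a * specRad A < 1) :
    IsUnit (1 - a • A) := by
  have ha' : (a : ℂ) ≠ 0 := by exact_mod_cast ha.ne'
  have hlt : spectralRadius ℂ (A.map (algebraMap ℝ ℂ)) < (‖((a : ℂ))⁻¹‖₊ : ENNReal) := by
    have e : (‖((a : ℂ))⁻¹‖₊ : ENNReal) = (ENNReal.ofReal a)⁻¹ := by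
      rw [← ENNReal.ofReal_inv_of_pos ha, ← enorm_eq_nnnorm, ← ofReal_norm]
      simp [abs_of_pos ha]
    rw [e, ← one_div, ENNReal.lt_div_iff_mul_lt (by simp [ha]) (by simp), mul_comm]
    exact h
  have hu := spectrum.mem_resolventSet_of_spectralRadius_lt hlt
  rw [spectrum.mem_resolventSet_iff, Matrix.isUnit_iff_isUnit_det, isUnit_iff_ne_zero] at hu
  rw [Matrix.isUnit_iff_isUnit_det, isUnit_iff_ne_zero]
  intro h0
  apply hu
  have e : algebraMap ℂ (Matrix ι ι ℂ) (a : ℂ)⁻¹ - A.map (algebraMap ℝ ℂ) =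
      (a : ℂ)⁻¹ • (algebraMap ℝ ℂ).mapMatrix (1 - a • A) := by
    ext i k
    by_cases hik : i = k
    · subst hik
      simp [Matrix.algebraMap_matrix_apply]
      field_simp
    · simp [Matrix.algebraMap_matrix_apply, hik]
      field_simp
  rw [e, Matrix.det_smul, ← RingHom.map_det, h0, map_zero, mul_zero]

/-- Blockwise form of `v ᵥ* (I - B)`, for `v` with blocks `w 1, …, w M`. -/
theorem vecMul_one_sub_blockB {n M : ℕ} (a : ℝ) (β : ℕ → ℝ) (hβ1 : β 1 = 0)
    (A : ℕ → Matrix (Fin n) (Fin n) ℝ) (w : ℕ → Fin n → ℝ) (k : Fin M) (y : Fin n) :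
    ((fun p : Fin M × Fin n => w (p.1.1 + 1) p.2) ᵥ* (1 - blockB M a β A)) (k, y) =
      (w (k.1 + 1) ᵥ* (1 - a • A (k.1 + 1))) y - β (k.1 + 1) * w k.1 y := by
  rw [Matrix.vecMul_sub, Matrix.vecMul_sub, Matrix.vecMul_one, Matrix.vecMul_one, Pi.sub_apply,
    Pi.sub_apply, sub_sub]
  congr 1
  have hB : ∀ l x, blockB M a β A (l, x) (k, y) =
      (if l = k then a * A (k.1 + 1) x y else 0) +
        (if l.1 + 1 = k.1 then (if x = y then β (k.1 + 1) else 0) else 0) := by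
    intro l x
    by_cases h : l = k
    · subst h; simp [blockB]
    · simp [blockB, h]
  simp only [Matrix.vecMul, dotProduct, Fintype.sum_prod_type, hB, mul_add,
    Finset.sum_add_distrib]
  congr 1
  · rw [Finset.sum_eq_single k (by intro l _ h; simp [h]) (by simp)]
    simp
  · obtain ⟨k, hk⟩ := k
    cases k with
    | zero => simp [hβ1]
    | succ m =>
      rw [Finset.sum_eq_single ⟨m, by omega⟩ _ (by simp)]
      · simp [mul_comm]
      · intro l _ h
        have : l.1 ≠ m := fun e => h (Fin.ext e)
        simp [this]

/-- `I - B` is invertible as soon as all its diagonal blocks are. -/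
theorem isUnit_one_sub_blockB {n M : ℕ} (a : ℝ) (β : ℕ → ℝ) (hβ1 : β 1 = 0)
    (A : ℕ → Matrix (Fin n) (Fin n) ℝ)
    (hA : ∀ s, 1 ≤ s → s ≤ M → IsUnit (1 - a • A s)) :
    IsUnit (1 - blockB M a β A) := by
  rw [← Matrix.vecMul_injective_iff_isUnit]
  refine (injective_iff_map_eq_zero (Matrix.vecMulLinear (1 - blockB M a β A))).2 fun v hv => ?_
  let w : ℕ → Fin n → ℝ := fun s x => if h : 1 ≤ s ∧ s ≤ M then v (⟨s - 1, by omega⟩, x) else 0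
  have hvw : v = fun p : Fin M × Fin n => w (p.1.1 + 1) p.2 := by
    ext ⟨⟨k, hk⟩, x⟩
    simp [w, Nat.succ_le_of_lt hk]
  have hw : ∀ s, s ≤ M → w s = 0 := by
    intro s
    induction s with
    | zero => intro _; ext x; simp [w]
    | succ s ih =>
      intro hs
      apply Matrix.vecMul_injective_iff_isUnit.2 (hA (s + 1) (by omega) hs)
      ext y
      have h1 := vecMul_one_sub_blockB a β hβ1 A w ⟨s, hs⟩ y
      rw [← hvw] at h1
      have h2 : (v ᵥ* (1 - blockB M a β A)) (⟨s, hs⟩, y) = 0 := congrFun hv _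
      rw [h2, ih (by omega)] at h1
      simpa using h1.symm
  rw [hvw]
  ext ⟨⟨k, hk⟩, x⟩
  simp [hw (k + 1) hk]

/-- Vectorized broadcast communicability formula: with `d ∈ ℝ^M` given
by `d_1 = 1`, `d_i = 1 - β_i` (`i ≥ 2`), `e_j` the `j`-th standard basis vector of `ℝ^M`
and `1_n` the all-ones vector, for each `j = 1,…,M`:
`S^[j] 1_n = (d ⊗ I_n)ᵀ (I - B)⁻¹ (e_j ⊗ 1_n) - 1_n`.
Here `d ⊗ I_n` is the `Mn × n` matrix whose `i`-th block is `d_i I_n` and `e_j ⊗ 1_n` is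
the `Mn`-vector whose `j`-th block is `1_n`, other blocks zero. -/
theorem broadcast_communicability_vectorized {n M : ℕ}
    (A : ℕ → Matrix (Fin n) (Fin n) ℝ)
    (a b : ℝ) (ha : 0 < a) (hb : 0 < b)
    (hρ : ∀ s, 1 ≤ s → s ≤ M → ENNReal.ofReal a * specRad (A s) < 1)
    (Δt : ℕ → ℝ) (hΔt : ∀ ℓ, 2 ≤ ℓ → ℓ ≤ M → 0 < Δt ℓ)
    (β : ℕ → ℝ) (hβ1 : β 1 = 0)
    (hβ : ∀ ℓ, 2 ≤ ℓ → ℓ ≤ M → β ℓ = Real.exp (-(b * Δt ℓ)))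
    (B : Matrix (Fin M × Fin n) (Fin M × Fin n) ℝ) (hB : B = blockB M a β A)
    (S : ℕ → Matrix (Fin n) (Fin n) ℝ) (hS0 : S 0 = 0)
    (hS : ∀ j, 1 ≤ j → j ≤ M →
      S j = (1 + β j • S (j - 1)) * (1 - a • A j)⁻¹ - 1)
    (d : ℕ → ℝ) (hd1 : d 1 = 1) (hdi : ∀ i, 2 ≤ i → i ≤ M → d i = 1 - β i)
    (j : ℕ) (hj1 : 1 ≤ j) (hjM : j ≤ M) :
    (S j).mulVec (fun _ => 1) =
      ((show Matrix (Fin M × Fin n) (Fin n) ℝ from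
          fun p y => d (p.1.1 + 1) * (if p.2 = y then 1 else 0))ᵀ *
        (1 - B)⁻¹).mulVec
          (fun p : Fin M × Fin n => if p.1.1 + 1 = j then 1 else 0)
      - (fun _ => 1) := by
  subst hB
  have hA : ∀ s, 1 ≤ s → s ≤ M → IsUnit (1 - a • A s) := fun s h1 h2 =>
    isUnit_one_sub_smul_of_specRad_lt ha (hρ s h1 h2)
  have hdet := (Matrix.isUnit_iff_isUnit_det _).1 (isUnit_one_sub_blockB a β hβ1 A hA)
  let R : Matrix (Fin n) (Fin M × Fin n) ℝ := fun x p => (S (p.1.1 + 1) + 1) x p.2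
  let D : Matrix (Fin M × Fin n) (Fin n) ℝ :=
    fun p y => d (p.1.1 + 1) * (if p.2 = y then 1 else 0)
  have hR : R * (1 - blockB M a β A) = Dᵀ := by
    ext x ⟨k, y⟩
    have hk : k.1 + 1 ≤ M := k.2
    have hd : d (k.1 + 1) = 1 - β (k.1 + 1) := by
      rcases Nat.eq_zero_or_pos k.1 with h | h
      · simp [h, hd1, hβ1]
      · exact hdi _ (by omega) hk
    have hmul : (S (k.1 + 1) + 1) * (1 - a • A (k.1 + 1)) = 1 + β (k.1 + 1) • S k.1 := by
      rw [hS _ (by omega) hk, sub_add_cancel, Matrix.mul_assoc,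
        Matrix.nonsing_inv_mul _ ((Matrix.isUnit_iff_isUnit_det _).1 (hA _ (by omega) hk)),
        Matrix.mul_one, Nat.add_sub_cancel]
    have h1 := vecMul_one_sub_blockB a β hβ1 A (fun s => (S s + 1) x) k y
    change (R * (1 - blockB M a β A) : Matrix (Fin n) (Fin M × Fin n) ℝ) x (k, y) =
      ((S (k.1 + 1) + 1) * (1 - a • A (k.1 + 1)) : Matrix (Fin n) (Fin n) ℝ) x y -
        β (k.1 + 1) * (S k.1 + 1) x y at h1
    rw [h1, hmul]
    have hDk : Dᵀ x (k, y) = d (k.1 + 1) * (if y = x then 1 else 0) := rfl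
    rw [hDk, hd]
    simp only [Matrix.add_apply, Matrix.smul_apply, smul_eq_mul, Matrix.one_apply,
      eq_comm (a := y)]
    ring
  have hDR : Dᵀ * (1 - blockB M a β A)⁻¹ = R := by
    rw [← hR, Matrix.mul_nonsing_inv_cancel_right _ _ hdet]
  change _ = (Dᵀ * (1 - blockB M a β A)⁻¹) *ᵥ _ - _
  rw [hDR, eq_sub_iff_add_eq]
  ext x
  have hj : ∀ l : Fin M, l.1 + 1 = j ↔ l = ⟨j - 1, by omega⟩ := fun l => by
    rw [Fin.ext_iff]; simp only; omega
  simp [R, Matrix.mulVec, dotProduct, Fintype.sum_prod_type, hj, Finset.sum_add_distrib,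
    Nat.sub_add_cancel hj1, Matrix.one_apply]
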